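/- arXiv:1101.2075 — 2 statements merged into one kernel-verified Lean document; each statement's English description precedes it below -/
import Mathlib

section
/- Let w₀ be the longest element of W and, for J ⊆ S, set J^{w₀} = w₀Jw₀ ⊆ S. Then, with σ ≡ 1, for every J ⊆ S: w₀ e_J = (−1)^{|J|} e_J, w₀ e_J w₀ = e_{J^{w₀}}, and e_J w₀ = (−1)^{|J|} e_{J^{w₀}}. -/
open scoped Classical
open MonoidAlgebra Finset

noncomputable section

namespace DPR

variable {B : Type} {W : Type} [Group W] [Fintype W] [DecidableEq W]
  {M : CoxeterMatrix B}

/-- The set `S` of simple reflections of the Coxeter system, as a finset of `W`. -/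
def Simples (cs : CoxeterSystem M W) : Finset W :=
  Finset.univ.filter (fun w => ∃ i, cs.simple i = w)

/-- The set `W^I` of minimal length left coset representatives of `W_I`,
computed inside the subset `H` of `W` (take `H = Set.univ` for the absolute case). -/
def minCoset (cs : CoxeterSystem M W) (H : Set W) (I : Finset W) : Finset W :=
  Finset.univ.filter (fun w => w ∈ H ∧ ∀ s ∈ I, cs.length w < cs.length (w * s))

/-- The element `x_I = ∑_{w ∈ W^I} w` of the group algebra `ℂ W`, relative to `H`. -/
def xRel (cs : CoxeterSystem M W) (H : Set W) (I : Finset W) : MonoidAlgebra ℂ W :=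
  ∑ w ∈ minCoset cs H I, of ℂ W w

/-- `w(Δ_J) ⊆ Δ_D`:  for every `s ∈ J`, `wsw⁻¹ ∈ D` and `ℓ(ws) = ℓ(w) + 1`. -/
def Takes (cs : CoxeterSystem M W) (D : Finset W) (w : W) (J : Finset W) : Prop :=
  ∀ s ∈ J, w * s * w⁻¹ ∈ D ∧ cs.length (w * s) = cs.length w + 1

/-- `ᵂJ = wJw⁻¹`. -/
def conjF (w : W) (J : Finset W) : Finset W := J.image (fun s => w * s * w⁻¹)

/-- The coefficient `m^σ_{JK}`, computed relative to the pair `(H, D)`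
(`H = Set.univ`, `D = S` in the absolute case). -/
def mC (cs : CoxeterSystem M W) (H : Set W) (D : Finset W) (σ : Finset W → ℝ)
    (J K : Finset W) : ℝ :=
  if J ⊆ K then
    ∑ w ∈ (minCoset cs H K).filter (fun w => Takes cs D w J), σ (conjF w J)
  else 0

/-- The family `(e_J)` is a family of BBHT quasi-idempotents, relative to `(H, D, σ)`:
it solves the defining triangular system `x_K = ∑_{J ⊆ K} m^σ_{JK} e_J` for all `K ⊆ D`. -/
def IsBBHT (cs : CoxeterSystem M W) (H : Set W) (D : Finset W) (σ : Finset W → ℝ)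
    (e : Finset W → MonoidAlgebra ℂ W) : Prop :=
  ∀ K ∈ D.powerset, xRel cs H K = ∑ J ∈ K.powerset, (mC cs H D σ J K : ℂ) • e J

/-- `σ` takes positive values (on subsets of `D`). -/
def PosOn (D : Finset W) (σ : Finset W → ℝ) : Prop := ∀ I ∈ D.powerset, 0 < σ I

/-- Two subsets of `S` have the same shape if the parabolic subgroups they generate
are conjugate in `W`. -/
def ShapeEq (I J : Finset W) : Prop :=
  ∃ w : W, Subgroup.closure (J : Set W) =
    Subgroup.map (MulAut.conj w).toMonoidHom (Subgroup.closure (I : Set W))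

/-- Solomon's descent algebra, as a subspace of the group algebra: the span of the `x_I`. -/
def descAlg (cs : CoxeterSystem M W) : Submodule ℂ (MonoidAlgebra ℂ W) :=
  Submodule.span ℂ {a | ∃ I ∈ (Simples cs).powerset, a = xRel cs Set.univ I}

section InversionCocycle

omit [Fintype W]

variable (cs : CoxeterSystem M W)

theorem end_mul_apply {α : Type*} (f g : Function.End α) (a : α) : (f * g) a = f (g a) := rfl

theorem end_one_apply {α : Type*} (a : α) : (1 : Function.End α) a = a := rfl

/-- The action of the simple reflection `s i` on signed elements of `W`: conjugation by `s i`,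
flipping the sign of `s i`. -/
def signedConj (i : B) : Function.End (W × ZMod 2) := fun p =>
  (cs.simple i * p.1 * cs.simple i, p.2 + if p.1 = cs.simple i then 1 else 0)

theorem signedConj_mul_pow_apply (i j : B) (n : ℕ) (t : W) (ε : ZMod 2) :
    ((signedConj cs i * signedConj cs j) ^ n) (t, ε) =
      ((cs.simple i * cs.simple j) ^ n * t * ((cs.simple i * cs.simple j) ^ n)⁻¹,
        ε + ∑ k ∈ range (2 * n),
          if (cs.simple i * cs.simple j) ^ k * t = cs.simple j then 1 else 0) := by
  have hr : ∀ k : ℕ, (cs.simple i * cs.simple j) ^ k * cs.simple j *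
      (cs.simple i * cs.simple j) ^ k = cs.simple j := by
    intro k
    induction k with
    | zero => simp
    | succ k ih =>
      rw [← ih]
      nth_rw 1 [pow_succ]
      rw [pow_succ', ih]
      simpa [mul_assoc] using ih
  induction n with
  | zero => simp [end_one_apply]
  | succ n ih =>
    rw [pow_succ', end_mul_apply, ih, end_mul_apply]
    simp only [signedConj]
    have hrn := hr n
    have hcomm := pow_succ' (cs.simple i * cs.simple j) n
    have hcomm' := pow_succ (cs.simple i * cs.simple j) n
    have h1 : (cs.simple i * cs.simple j) ^ (2 * n) =
      (cs.simple i * cs.simple j) ^ n * (cs.simple i * cs.simple j) ^ n := by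
        rw [two_mul, pow_add]
    have h2 : (cs.simple i * cs.simple j) ^ (2 * n + 1) =
      (cs.simple i * cs.simple j) ^ n * (cs.simple i * cs.simple j) *
        (cs.simple i * cs.simple j) ^ n := by
        rw [← hcomm', ← pow_add]
        congr 1
        ring
    rw [show 2 * (n + 1) = 2 * n + 1 + 1 by ring, sum_range_succ, sum_range_succ, h1, h2, hcomm]
    have hi := cs.simple_mul_simple_self i
    have hj := cs.simple_mul_simple_self j
    generalize (cs.simple i * cs.simple j) ^ n = x at *
    refine Prod.ext ?_ ?_
    · simp [mul_assoc]
    · have c1 : x * t * x⁻¹ = cs.simple j ↔ x * x * t = cs.simple j := by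
        rw [mul_inv_eq_iff_eq_mul]
        nth_rw 2 [← hrn]
        rw [mul_assoc x x, mul_assoc x _ x, mul_right_inj]
      have hy : x * (cs.simple i * cs.simple j) * x *
          (x⁻¹ * cs.simple j * cs.simple i * cs.simple j * x) = cs.simple j := by
        simpa [mul_assoc] using hrn
      have c2 : cs.simple j * (x * t * x⁻¹) * cs.simple j = cs.simple i ↔
          x * (cs.simple i * cs.simple j) * x * t = cs.simple j := by
        calc
          _ ↔ t = x⁻¹ * cs.simple j * cs.simple i * cs.simple j * x := by
            rw [← mul_left_inj (cs.simple j), ← mul_right_inj (cs.simple j), ← mul_left_inj x,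
              ← mul_right_inj x⁻¹]
            simp [mul_assoc]
          _ ↔ _ := by rw [← mul_right_inj (x * (cs.simple i * cs.simple j) * x), hy]
      simp only [c1, c2, add_assoc]

theorem isLiftable_signedConj : M.IsLiftable (signedConj cs) := by
  intro i j
  funext ⟨t, ε⟩
  rw [signedConj_mul_pow_apply, cs.simple_mul_simple_pow, two_mul, sum_range_add]
  simp only [pow_add, cs.simple_mul_simple_pow, one_mul, ← two_mul]
  rw [show (2 : ZMod 2) = 0 from rfl]
  simp [end_one_apply]

/-- The number, modulo two, of occurrences of `t` in the right inversion sequence of any word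
representing `w`. -/
def invParity (w t : W) : ZMod 2 := (cs.lift ⟨signedConj cs, isLiftable_signedConj cs⟩ w (t, 0)).2

theorem lift_signedConj_wordProd (ω : List B) (t : W) (ε : ZMod 2) :
    cs.lift ⟨signedConj cs, isLiftable_signedConj cs⟩ (cs.wordProd ω) (t, ε) =
      (cs.wordProd ω * t * (cs.wordProd ω)⁻¹, ε + ((cs.rightInvSeq ω).count t : ZMod 2)) := by
  induction ω with
  | nil => simp [end_one_apply]
  | cons i ω ih =>
    rw [cs.wordProd_cons, map_mul, end_mul_apply, ih,
      cs.lift_apply_simple]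
    have h : cs.wordProd ω * t * (cs.wordProd ω)⁻¹ = cs.simple i ↔
        (cs.wordProd ω)⁻¹ * cs.simple i * cs.wordProd ω = t := by
      constructor
      · intro h
        rw [← h]; group
      · intro h
        rw [← h]; group
    simp only [signedConj, CoxeterSystem.rightInvSeq, List.count_cons, beq_iff_eq, h,
      Nat.cast_add, Nat.cast_ite, Nat.cast_one, Nat.cast_zero]
    simp only [add_assoc, mul_inv_rev, cs.inv_simple, mul_assoc]

theorem lift_signedConj_apply (w t : W) (ε : ZMod 2) :
    cs.lift ⟨signedConj cs, isLiftable_signedConj cs⟩ w (t, ε) =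
      (w * t * w⁻¹, ε + invParity cs w t) := by
  obtain ⟨ω, rfl⟩ := cs.wordProd_surjective w
  rw [invParity, lift_signedConj_wordProd, lift_signedConj_wordProd, zero_add]

theorem invParity_wordProd (ω : List B) (t : W) :
    invParity cs (cs.wordProd ω) t = (cs.rightInvSeq ω).count t := by
  rw [invParity, lift_signedConj_wordProd, zero_add]

theorem invParity_mul (x y t : W) :
    invParity cs (x * y) t = invParity cs y t + invParity cs x (y * t * y⁻¹) := by
  rw [invParity, map_mul, end_mul_apply, lift_signedConj_apply,
    lift_signedConj_apply, zero_add]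

theorem invParity_simple (i : B) : invParity cs (cs.simple i) (cs.simple i) = 1 := by
  rw [← cs.wordProd_singleton, invParity_wordProd]
  simp

theorem invParity_one (t : W) : invParity cs 1 t = 0 := by
  rw [← cs.wordProd_nil, invParity_wordProd]
  simp

theorem invParity_self {t : W} (ht : cs.IsReflection t) : invParity cs t t = 1 := by
  obtain ⟨u, i, rfl⟩ := ht
  have h := invParity_mul cs u u⁻¹ (u * cs.simple i * u⁻¹)
  rw [mul_inv_cancel, invParity_one] at h
  rw [invParity_mul, invParity_mul]
  have e : u⁻¹ * (u * cs.simple i * u⁻¹) * u⁻¹⁻¹ = cs.simple i := by group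
  rw [e] at h ⊢
  simp only [mul_inv_cancel_right, invParity_simple]
  rw [add_left_comm, ← h, add_zero]

theorem mem_rightInvSeq_of_invParity_ne_zero {ω : List B} {t : W}
    (h : invParity cs (cs.wordProd ω) t ≠ 0) : t ∈ cs.rightInvSeq ω := by
  by_contra h'
  rw [invParity_wordProd, List.count_eq_zero_of_not_mem h'] at h
  simp at h

theorem invParity_ne_zero_iff {w t : W} : invParity cs w t ≠ 0 ↔ cs.IsRightInversion w t := by
  have key : ∀ w, invParity cs w t ≠ 0 → cs.IsRightInversion w t := by
    intro w h
    obtain ⟨ω, hω, rfl⟩ := cs.exists_isReduced w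
    exact cs.isRightInversion_of_mem_rightInvSeq hω (mem_rightInvSeq_of_invParity_ne_zero cs h)
  refine ⟨key w, fun h h0 => ?_⟩
  have ht := h.1
  refine ht.isRightInversion_mul_left_iff.1 (key (w * t) ?_) h
  rw [invParity_mul, invParity_self cs ht, ht.inv, mul_assoc, ht.mul_self, mul_one, h0]
  decide

/-- The exchange property. -/
theorem mem_rightInvSeq_of_isRightInversion {ω : List B} {t : W}
    (h : cs.IsRightInversion (cs.wordProd ω) t) : t ∈ cs.rightInvSeq ω :=
  mem_rightInvSeq_of_invParity_ne_zero cs ((invParity_ne_zero_iff cs).2 h)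

theorem isRightInversion_mul_iff (x y t : W) :
    cs.IsRightInversion (x * y) t ↔
      (cs.IsRightInversion y t ↔ ¬ cs.IsRightInversion x (y * t * y⁻¹)) := by
  rw [← invParity_ne_zero_iff, ← invParity_ne_zero_iff, ← invParity_ne_zero_iff, invParity_mul]
  generalize invParity cs y t = a
  generalize invParity cs x (y * t * y⁻¹) = b
  revert a b
  decide

end InversionCocycle

section Parabolic

omit [DecidableEq W]

variable (cs : CoxeterSystem M W)

theorem mem_Simples {w : W} : w ∈ Simples cs ↔ ∃ i, cs.simple i = w := by
  simp [Simples]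

theorem isReflection_of_mem_Simples {s : W} (hs : s ∈ Simples cs) : cs.IsReflection s := by
  obtain ⟨i, rfl⟩ := (mem_Simples cs).1 hs
  exact cs.isReflection_simple i

theorem isRightInversion_simple_left_iff {s t : W} (hs : s ∈ Simples cs) :
    cs.IsRightInversion s t ↔ t = s := by
  obtain ⟨i, rfl⟩ := (mem_Simples cs).1 hs
  constructor
  · intro h
    have := mem_rightInvSeq_of_isRightInversion cs (ω := [i]) (by simpa using h)
    simpa using this
  · rintro rfl
    simp [CoxeterSystem.IsRightDescent]

omit [Fintype W] in
theorem not_isRightInversion_one (t : W) : ¬ cs.IsRightInversion 1 t := by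
  simp [CoxeterSystem.IsRightInversion]

theorem exists_isReduced_of_mem_closure {J : Finset W} (hJ : J ⊆ Simples cs) {v : W}
    (hv : v ∈ Subgroup.closure (J : Set W)) :
    ∃ ω : List B, cs.IsReduced ω ∧ cs.wordProd ω = v ∧ ∀ i ∈ ω, cs.simple i ∈ J := by
  have hinv : (J : Set W)⁻¹ ⊆ J := by
    intro s hs
    have hs' : s⁻¹ ∈ J := hs
    rw [← (isReflection_of_mem_Simples cs (hJ hs')).inv, inv_inv] at hs'
    exact hs'
  rw [← SetLike.mem_coe, ← Subgroup.coe_toSubmonoid, Subgroup.closure_toSubmonoid,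
    Set.union_eq_self_of_subset_right hinv] at hv
  induction hv using Submonoid.closure_induction_right with
  | one => exact ⟨[], by simp [CoxeterSystem.IsReduced], by simp, by simp⟩
  | mul_right v _ s hs ih =>
    obtain ⟨ω, hω, rfl, hωJ⟩ := ih
    obtain ⟨i, rfl⟩ := (mem_Simples cs).1 (hJ hs)
    have hlen : cs.length (cs.wordProd ω) = ω.length := hω
    rcases cs.length_mul_simple (cs.wordProd ω) i with h | h
    · refine ⟨ω ++ [i], ?_, by simp [cs.wordProd_append], ?_⟩
      · simp [CoxeterSystem.IsReduced, cs.wordProd_append, h, hlen]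
      · simpa [or_imp, forall_and] using ⟨hωJ, hs⟩
    · have hmem : cs.simple i ∈ cs.rightInvSeq ω :=
        mem_rightInvSeq_of_isRightInversion cs ⟨cs.isReflection_simple i, by omega⟩
      obtain ⟨k, hk, hki⟩ := List.mem_iff_getElem.1 hmem
      have hprod := cs.wordProd_mul_getD_rightInvSeq ω k
      rw [List.getD_eq_getElem _ _ hk, hki] at hprod
      refine ⟨ω.eraseIdx k, ?_, hprod.symm, fun j hj => hωJ j (List.mem_of_mem_eraseIdx hj)⟩
      rw [cs.length_rightInvSeq] at hk
      have := List.length_eraseIdx_add_one hk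
      rw [CoxeterSystem.IsReduced, ← hprod]
      omega

theorem exists_isRightInversion_of_mem_closure {J : Finset W} (hJ : J ⊆ Simples cs) {v : W}
    (hv : v ∈ Subgroup.closure (J : Set W)) (hv1 : v ≠ 1) :
    ∃ s ∈ J, cs.IsRightInversion v s := by
  obtain ⟨ω, hω, rfl, hωJ⟩ := exists_isReduced_of_mem_closure cs hJ hv
  rcases List.eq_nil_or_concat ω with rfl | ⟨ω', i, rfl⟩
  · simp at hv1
  · refine ⟨cs.simple i, hωJ i (by simp), cs.isRightInversion_of_mem_rightInvSeq hω ?_⟩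
    rw [cs.rightInvSeq_concat]
    simp

theorem simple_ne_one {s : W} (hs : s ∈ Simples cs) : s ≠ 1 := by
  rintro rfl
  exact not_isRightInversion_one cs 1 ((isRightInversion_simple_left_iff cs hs).2 rfl)

theorem mem_of_mem_closure_of_mem_Simples {J : Finset W} (hJ : J ⊆ Simples cs) {s : W}
    (hs : s ∈ Simples cs) (hsJ : s ∈ Subgroup.closure (J : Set W)) : s ∈ J := by
  obtain ⟨s', hs', h⟩ := exists_isRightInversion_of_mem_closure cs hJ hsJ (simple_ne_one cs hs)
  rwa [(isRightInversion_simple_left_iff cs hs).1 h] at hs'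

theorem mem_closure_of_isRightInversion {J : Finset W} (hJ : J ⊆ Simples cs) {v t : W}
    (hv : v ∈ Subgroup.closure (J : Set W)) (h : cs.IsRightInversion v t) :
    t ∈ Subgroup.closure (J : Set W) := by
  obtain ⟨ω, hω, rfl, hωJ⟩ := exists_isReduced_of_mem_closure cs hJ hv
  have hmem := mem_rightInvSeq_of_isRightInversion cs h
  obtain ⟨k, hk, rfl⟩ := List.mem_iff_getElem.1 hmem
  have hprod := cs.wordProd_mul_getD_rightInvSeq ω k
  rw [List.getD_eq_getElem _ _ hk] at hprod
  rw [eq_inv_mul_of_mul_eq hprod]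
  refine mul_mem (inv_mem hv) ?_
  rw [CoxeterSystem.wordProd]
  refine list_prod_mem fun x hx => ?_
  obtain ⟨i, hi, rfl⟩ := List.mem_map.1 hx
  exact Subgroup.subset_closure (hωJ i (List.mem_of_mem_eraseIdx hi))

/-- `v` is the longest element of the standard parabolic subgroup `W_J`: its right inversions are
exactly the reflections of `W_J`. -/
structure IsLongestIn (J : Finset W) (v : W) : Prop where
  mem : v ∈ Subgroup.closure (J : Set W)
  isRightInversion : ∀ t ∈ Subgroup.closure (J : Set W), cs.IsReflection t →
    cs.IsRightInversion v t

theorem exists_isLongestIn (J : Finset W) : ∃ v, IsLongestIn cs J v := by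
  obtain ⟨v, hv, hmax⟩ := Finset.exists_max_image
    (Finset.univ.filter (fun v => v ∈ Subgroup.closure (J : Set W))) cs.length
    ⟨1, by simp [one_mem]⟩
  simp only [Finset.mem_filter, Finset.mem_univ, true_and] at hv hmax
  exact ⟨v, hv, fun t ht htr => ⟨htr, lt_of_le_of_ne (hmax _ (mul_mem hv ht))
    (htr.length_mul_left_ne v)⟩⟩

variable {cs}

theorem IsLongestIn.mul_self {J : Finset W} (hJ : J ⊆ Simples cs) {v : W}
    (hv : IsLongestIn cs J v) : v * v = 1 := by
  by_contra h
  obtain ⟨s, hs, hvs⟩ :=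
    exists_isRightInversion_of_mem_closure cs hJ (mul_mem hv.mem hv.mem) h
  have hsr := isReflection_of_mem_Simples cs (hJ hs)
  have hsJ : s ∈ Subgroup.closure (J : Set W) := Subgroup.subset_closure hs
  rw [isRightInversion_mul_iff] at hvs
  have h1 := hv.isRightInversion s hsJ hsr
  have h2 := hv.isRightInversion _ (mul_mem (mul_mem hv.mem hsJ) (inv_mem hv.mem)) (hsr.conj v)
  exact hvs.1 h1 h2

theorem IsLongestIn.inv_eq {J : Finset W} (hJ : J ⊆ Simples cs) {v : W}
    (hv : IsLongestIn cs J v) : v⁻¹ = v :=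
  inv_eq_of_mul_eq_one_left (hv.mul_self hJ)

theorem IsLongestIn.conj_mem {J : Finset W} (hJ : J ⊆ Simples cs) {v s : W}
    (hv : IsLongestIn cs J v) (hs : s ∈ J) : v * s * v⁻¹ ∈ J := by
  have hsJ : s ∈ Subgroup.closure (J : Set W) := Subgroup.subset_closure hs
  have hmem := mul_mem (mul_mem hv.mem hsJ) (inv_mem hv.mem)
  have hne : v * s * v⁻¹ ≠ 1 := by
    rw [Ne, conj_eq_one_iff]
    exact simple_ne_one cs (hJ hs)
  obtain ⟨s', hs', h⟩ := exists_isRightInversion_of_mem_closure cs hJ hmem hne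
  have hs'J : s' ∈ Subgroup.closure (J : Set W) := Subgroup.subset_closure hs'
  have hr := isReflection_of_mem_Simples cs (hJ hs')
  suffices s' = v * s * v⁻¹ from this ▸ hs'
  rw [isRightInversion_mul_iff, isRightInversion_mul_iff, hv.inv_eq hJ,
    isRightInversion_simple_left_iff cs (hJ hs)] at h
  have h1 := hv.isRightInversion s' hs'J hr
  have h2 := hv.isRightInversion (s * (v * s' * v⁻¹) * s⁻¹)
    (mul_mem (mul_mem hsJ (mul_mem (mul_mem hv.mem hs'J) (inv_mem hv.mem))) (inv_mem hsJ))
    ((hr.conj v).conj s)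
  have h3 : v * s' * v⁻¹ = s := by tauto
  rw [← h3, ← mul_assoc, ← mul_assoc, hv.mul_self hJ, one_mul, mul_assoc, ← mul_inv_rev,
    hv.mul_self hJ, inv_one, mul_one]

end Parabolic

section Counting

variable (cs : CoxeterSystem M W)

theorem mem_minCoset_univ {K : Finset W} (hK : K ⊆ Simples cs) {w : W} :
    w ∈ minCoset cs Set.univ K ↔ ∀ s ∈ K, ¬ cs.IsRightInversion w s := by
  simp only [minCoset, Finset.mem_filter, Finset.mem_univ, Set.mem_univ, true_and]
  refine forall₂_congr fun s hs => ?_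
  have hr := isReflection_of_mem_Simples cs (hK hs)
  have := hr.length_mul_left_ne w
  rw [CoxeterSystem.IsRightInversion, and_iff_right hr]
  omega

omit [DecidableEq W] in
theorem takes_iff {J : Finset W} (hJ : J ⊆ Simples cs) {w : W} :
    Takes cs (Simples cs) w J ↔
      ∀ s ∈ J, w * s * w⁻¹ ∈ Simples cs ∧ ¬ cs.IsRightInversion w s := by
  refine forall₂_congr fun s hs => and_congr_right fun _ => ?_
  obtain ⟨i, rfl⟩ := (mem_Simples cs).1 (hJ hs)
  rw [cs.isRightInversion_simple_iff_isRightDescent, cs.not_isRightDescent_iff]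

theorem mC_eq_card {J K : Finset W} (hJK : J ⊆ K) (hK : K ⊆ Simples cs) :
    mC cs Set.univ (Simples cs) (fun _ => 1) J K =
      #{w : W | Takes cs (Simples cs) w J ∧ ∀ s ∈ K \ J, ¬ cs.IsRightInversion w s} := by
  rw [mC, if_pos hJK, sum_const, nsmul_eq_mul, mul_one, Nat.cast_inj]
  congr 1
  ext w
  simp only [Finset.mem_filter, mem_minCoset_univ cs hK, Finset.mem_univ, true_and,
    takes_iff cs (hJK.trans hK), Finset.mem_sdiff]
  grind

variable {cs}

theorem isRightInversion_mul_longest_iff {J : Finset W} (hJ : J ⊆ Simples cs) {v w s : W}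
    (hv : IsLongestIn cs J v) (hw : Takes cs (Simples cs) w J) (hs : s ∈ Simples cs)
    (hsJ : s ∉ J) : cs.IsRightInversion (w * v) s ↔ cs.IsRightInversion w s := by
  have hJ' : conjF w J ⊆ Simples cs := by
    intro x hx
    obtain ⟨y, hy, rfl⟩ := Finset.mem_image.1 hx
    exact (hw y hy).1
  have hclos : Subgroup.closure (conjF w J : Set W) =
      (Subgroup.closure (J : Set W)).map (MulAut.conj w).toMonoidHom := by
    rw [MonoidHom.map_closure, conjF, Finset.coe_image]
    rfl
  have hmem : w * v * w⁻¹ ∈ Subgroup.closure (conjF w J : Set W) := by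
    rw [hclos]
    exact ⟨v, hv.mem, rfl⟩
  have hnot : ¬ cs.IsRightInversion (w * v * w⁻¹) (w * s * w⁻¹) := by
    intro h
    have h' := mem_closure_of_isRightInversion cs hJ' hmem h
    rw [hclos] at h'
    obtain ⟨x, hx, hxe⟩ := h'
    have : x = s := (MulAut.conj w).injective hxe
    exact hsJ (mem_of_mem_closure_of_mem_Simples cs hJ hs (this ▸ hx))
  have h := isRightInversion_mul_iff cs (w * v * w⁻¹) w s
  rw [inv_mul_cancel_right] at h
  tauto

omit [DecidableEq W] in
theorem takes_longest_mul_mul {J : Finset W} (hJ : J ⊆ Simples cs) {v w0 w : W}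
    (hv : IsLongestIn cs J v) (h0 : IsLongestIn cs (Simples cs) w0)
    (h0inv : ∀ t, cs.IsReflection t → cs.IsRightInversion w0 t)
    (hw : Takes cs (Simples cs) w J) : Takes cs (Simples cs) (w0 * w * v) J := by
  rw [takes_iff cs hJ] at hw ⊢
  intro s hs
  have hr := isReflection_of_mem_Simples cs (hJ hs)
  obtain ⟨h1, h2⟩ := hw _ (hv.conj_mem hJ hs)
  constructor
  · have := h0.conj_mem subset_rfl h1
    rwa [show w0 * w * v * s * (w0 * w * v)⁻¹ = w0 * (w * (v * s * v⁻¹) * w⁻¹) * w0⁻¹ by group]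
  · rw [isRightInversion_mul_iff, isRightInversion_mul_iff]
    have h3 := hv.isRightInversion s (Subgroup.subset_closure hs) hr
    have h4 := h0inv _ ((hr.conj v).conj w)
    tauto

theorem isRightInversion_longest_mul_mul_iff {J : Finset W} (hJ : J ⊆ Simples cs) {v w0 w s : W}
    (hv : IsLongestIn cs J v) (h0inv : ∀ t, cs.IsReflection t → cs.IsRightInversion w0 t)
    (hw : Takes cs (Simples cs) w J) (hs : s ∈ Simples cs) (hsJ : s ∉ J) :
    cs.IsRightInversion (w0 * w * v) s ↔ ¬ cs.IsRightInversion w s := by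
  have h4 := h0inv _ ((isReflection_of_mem_Simples cs hs).conj (w * v))
  rw [mul_assoc, isRightInversion_mul_iff, isRightInversion_mul_longest_iff hJ hv hw hs hsJ]
  tauto

theorem mC_eq_card_isRightInversion {J K : Finset W} (hJK : J ⊆ K) (hK : K ⊆ Simples cs)
    {w0 : W} (h0 : IsLongestIn cs (Simples cs) w0)
    (h0inv : ∀ t, cs.IsReflection t → cs.IsRightInversion w0 t) :
    mC cs Set.univ (Simples cs) (fun _ => 1) J K =
      #{w : W | Takes cs (Simples cs) w J ∧ ∀ s ∈ K \ J, cs.IsRightInversion w s} := by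
  have hJ := hJK.trans hK
  obtain ⟨v, hv⟩ := exists_isLongestIn cs J
  have hinvol : ∀ w, w0 * (w0 * w * v) * v = w := fun w => by
    rw [mul_assoc w0 w, ← mul_assoc w0 w0, h0.mul_self subset_rfl, one_mul, mul_assoc,
      hv.mul_self hJ, mul_one]
  rw [mC_eq_card cs hJK hK, Nat.cast_inj]
  refine Finset.card_nbij' (fun w => w0 * w * v) (fun w => w0 * w * v) ?_ ?_
    (fun w _ => hinvol w) (fun w _ => hinvol w)
  all_goals
    intro w hw
    simp only [Finset.coe_filter, Finset.mem_univ, true_and, Set.mem_ofPred_eq] at hw ⊢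
    refine ⟨takes_longest_mul_mul hJ hv h0 h0inv hw.1, fun s hs => ?_⟩
    have hs' := Finset.mem_sdiff.1 hs
    have := isRightInversion_longest_mul_mul_iff hJ hv h0inv hw.1 (hK hs'.1) hs'.2
    have := hw.2 s hs
    tauto

theorem sum_powerset_neg_one_pow_mul_ite {α R : Type*} [CommRing R] (A : Finset α)
    (p : α → Prop) :
    ∑ I ∈ A.powerset, (-1 : R) ^ #I * (if ∀ s ∈ I, ¬ p s then 1 else 0) =
      if ∀ s ∈ A, p s then 1 else 0 := by
  have h := Finset.prod_one_add (f := fun s => if p s then (0 : R) else -1) A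
  have h1 : ∀ I : Finset α, ∏ s ∈ I, (if p s then (0 : R) else -1) =
      (-1 : R) ^ #I * (if ∀ s ∈ I, ¬ p s then 1 else 0) := by
    intro I
    split_ifs with hI
    · rw [Finset.prod_congr rfl fun s hs => if_neg (hI s hs)]
      simp
    · push Not at hI
      obtain ⟨s, hs, hps⟩ := hI
      rw [mul_zero]
      exact Finset.prod_eq_zero hs (if_pos hps)
  simp only [← h1, ← h]
  split_ifs with hA
  · exact Finset.prod_eq_one fun s hs => by simp [hA s hs]
  · push Not at hA
    obtain ⟨s, hs, hps⟩ := hA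
    exact Finset.prod_eq_zero hs (by simp [hps])

theorem sum_Icc_neg_one_pow_mul_mC {J K : Finset W} (hJK : J ⊆ K) (hK : K ⊆ Simples cs)
    {w0 : W} (h0 : IsLongestIn cs (Simples cs) w0)
    (h0inv : ∀ t, cs.IsReflection t → cs.IsRightInversion w0 t) :
    ∑ I ∈ Finset.Icc J K, (-1 : ℝ) ^ #I * mC cs Set.univ (Simples cs) (fun _ => 1) J I =
      (-1 : ℝ) ^ #J * mC cs Set.univ (Simples cs) (fun _ => 1) J K := by
  rw [mC_eq_card_isRightInversion hJK hK h0 h0inv, Finset.card_filter, Nat.cast_sum,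
    Finset.Icc_eq_image_powerset hJK]
  rw [Finset.sum_image]
  swap
  · intro a ha b hb hab
    have ha := Finset.mem_powerset.1 ha
    have hb := Finset.mem_powerset.1 hb
    ext x
    have := congrArg (x ∈ ·) hab
    simp only [Finset.mem_union, eq_iff_iff] at this
    have := @ha x
    have := @hb x
    simp only [Finset.mem_sdiff] at *
    tauto
  have hterm : ∀ A ∈ (K \ J).powerset,
      (-1 : ℝ) ^ #(J ∪ A) * mC cs Set.univ (Simples cs) (fun _ => 1) J (J ∪ A) =
      ∑ w : W, (-1) ^ #J * if Takes cs (Simples cs) w J then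
        (-1 : ℝ) ^ #A * (if ∀ s ∈ A, ¬ cs.IsRightInversion w s then 1 else 0) else 0 := by
    intro A hA
    rw [Finset.mem_powerset] at hA
    have hdisj : Disjoint J A := Finset.disjoint_of_subset_right hA Finset.disjoint_sdiff
    have hsub : J ∪ A ⊆ Simples cs :=
      Finset.union_subset (hJK.trans hK) ((hA.trans Finset.sdiff_subset).trans hK)
    rw [mC_eq_card cs Finset.subset_union_left hsub, Finset.union_sdiff_cancel_left hdisj,
      Finset.card_union_of_disjoint hdisj, pow_add, Finset.card_filter, Nat.cast_sum,
      Finset.mul_sum]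
    refine Finset.sum_congr rfl fun w _ => ?_
    split_ifs <;> simp_all
  rw [Finset.sum_congr rfl hterm, Finset.sum_comm, Finset.mul_sum]
  refine Finset.sum_congr rfl fun w _ => ?_
  rw [← Finset.mul_sum]
  congr 1
  by_cases hw : Takes cs (Simples cs) w J
  · simp only [hw, if_true, true_and]
    have h := sum_powerset_neg_one_pow_mul_ite (R := ℝ) (K \ J) (cs.IsRightInversion w)
    convert h using 1
    · refine Finset.sum_congr rfl fun I _ => ?_
      congr
    · split_ifs <;> simp
  · simp [hw]

end Counting

section QuasiIdempotents

variable {cs : CoxeterSystem M W}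

theorem mC_self_ne_zero {J : Finset W} (hJ : J ⊆ Simples cs) :
    mC cs Set.univ (Simples cs) (fun _ => 1) J J ≠ 0 := by
  rw [mC_eq_card cs subset_rfl hJ, Nat.cast_ne_zero, Finset.card_ne_zero]
  refine ⟨1, ?_⟩
  simp only [Finset.mem_filter, Finset.mem_univ, true_and, takes_iff cs hJ]
  refine ⟨fun s hs => ⟨by simpa using hJ hs, not_isRightInversion_one cs s⟩,
    fun s _ => not_isRightInversion_one cs s⟩

/-- The defining system of the quasi-idempotents is triangular, hence has at most one solution. -/
theorem IsBBHT.eq_of_subset {e e' : Finset W → MonoidAlgebra ℂ W}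
    (he : IsBBHT cs Set.univ (Simples cs) (fun _ => 1) e)
    (he' : IsBBHT cs Set.univ (Simples cs) (fun _ => 1) e') {J : Finset W}
    (hJ : J ⊆ Simples cs) : e J = e' J := by
  induction J using Finset.strongInduction with
  | H J ih =>
    have h := (he J (Finset.mem_powerset.2 hJ)).symm.trans (he' J (Finset.mem_powerset.2 hJ))
    rw [← Finset.add_sum_erase _ _ (Finset.mem_powerset_self J),
      ← Finset.add_sum_erase J.powerset (fun I => _ • e' I) (Finset.mem_powerset_self J),
      Finset.sum_congr rfl fun I hI => ?_, add_left_inj] at h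
    · exact smul_right_injective _ (Complex.ofReal_ne_zero.2 (mC_self_ne_zero hJ)) h
    · rw [Finset.mem_erase, Finset.mem_powerset] at hI
      have hlt : I ⊂ J := hI.2.ssubset_of_ne hI.1
      rw [ih I hlt (hI.2.trans hJ)]

variable {w0 : W}

omit [Fintype W] [DecidableEq W] in
theorem isRightInversion_of_maximal (hw0 : ∀ w : W, w ≠ w0 → cs.length w < cs.length w0)
    (t : W) (ht : cs.IsReflection t) : cs.IsRightInversion w0 t :=
  ⟨ht, hw0 _ fun h => ht.length_mul_left_ne w0 (by rw [h])⟩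

omit [DecidableEq W] in
theorem closure_Simples : Subgroup.closure (Simples cs : Set W) = ⊤ := by
  rw [← cs.subgroup_closure_range_simple]
  congr 1
  ext w
  simp [Simples]

omit [DecidableEq W] in
theorem isLongestIn_Simples_of_maximal
    (hw0 : ∀ w : W, w ≠ w0 → cs.length w < cs.length w0) : IsLongestIn cs (Simples cs) w0 :=
  ⟨closure_Simples (cs := cs) ▸ Subgroup.mem_top w0,
    fun t _ ht => isRightInversion_of_maximal hw0 t ht⟩

theorem of_mul_xRel
    (h0inv : ∀ t, cs.IsReflection t → cs.IsRightInversion w0 t)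
    {K : Finset W} (hK : K ⊆ Simples cs) :
    of ℂ W w0 * xRel cs Set.univ K =
      ∑ I ∈ K.powerset, (-1 : ℂ) ^ #I • xRel cs Set.univ I := by
  have hx : ∀ I ∈ K.powerset, xRel cs Set.univ I =
      ∑ w : W, (if ∀ s ∈ I, ¬ cs.IsRightInversion w s then (1 : ℂ) else 0) • of ℂ W w := by
    intro I hI
    simp only [ite_smul, one_smul, zero_smul, ← Finset.sum_filter]
    refine Finset.sum_congr ?_ fun _ _ => rfl
    ext w
    simp [mem_minCoset_univ cs ((Finset.mem_powerset.1 hI).trans hK)]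
  have hsign : ∀ w : W, ∑ I ∈ K.powerset,
      (-1 : ℂ) ^ #I * (if ∀ s ∈ I, ¬ cs.IsRightInversion w s then 1 else 0) =
      if ∀ s ∈ K, cs.IsRightInversion w s then 1 else 0 := fun w => by
    convert sum_powerset_neg_one_pow_mul_ite (R := ℂ) K (cs.IsRightInversion w)
  have hflip : ∀ w, ∀ s ∈ K, cs.IsRightInversion (w0 * w) s ↔ ¬ cs.IsRightInversion w s := by
    intro w s hs
    have := h0inv _ ((isReflection_of_mem_Simples cs (hK hs)).conj w)
    rw [isRightInversion_mul_iff]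
    tauto
  rw [hx K (Finset.mem_powerset_self K),
    Finset.sum_congr (s₁ := K.powerset) rfl fun I hI => by rw [hx I hI]]
  simp only [Finset.smul_sum, Finset.mul_sum, smul_smul]
  rw [Finset.sum_comm]
  simp only [← Finset.sum_smul, hsign, mul_smul_comm, ← map_mul]
  refine Fintype.sum_equiv (Equiv.mulLeft w0) _ _ fun w => ?_
  rw [Equiv.coe_mulLeft]
  congr 1
  exact if_congr (forall₂_congr fun s hs => (hflip w s hs).symm) rfl rfl

theorem IsBBHT.smul_of_mul {e : Finset W → MonoidAlgebra ℂ W}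
    (he : IsBBHT cs Set.univ (Simples cs) (fun _ => 1) e)
    (h0 : IsLongestIn cs (Simples cs) w0)
    (h0inv : ∀ t, cs.IsReflection t → cs.IsRightInversion w0 t) :
    IsBBHT cs Set.univ (Simples cs) (fun _ => 1)
      (fun J => (-1 : ℂ) ^ #J • (of ℂ W w0 * e J)) := by
  intro K hK
  rw [Finset.mem_powerset] at hK
  have hw : of ℂ W w0 * (of ℂ W w0 * xRel cs Set.univ K) = xRel cs Set.univ K := by
    rw [← mul_assoc, ← map_mul, h0.mul_self subset_rfl, map_one, one_mul]
  rw [← hw, of_mul_xRel h0inv hK, Finset.sum_congr rfl fun I hI => by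
    rw [he I (Finset.mem_powerset.2 ((Finset.mem_powerset.1 hI).trans hK))]]
  simp only [Finset.smul_sum, smul_smul]
  rw [Finset.sum_comm' (t' := K.powerset) (s' := fun J => Finset.Icc J K)]
  swap
  · intro I J
    simp only [Finset.mem_powerset, Finset.mem_Icc]
    exact ⟨fun h => ⟨⟨h.2, h.1⟩, h.2.trans h.1⟩, fun h => ⟨h.1.2, h.1.1⟩⟩
  rw [Finset.mul_sum]
  refine Finset.sum_congr rfl fun J hJ => ?_
  have h := congrArg (fun x : ℝ => (x : ℂ))
    (sum_Icc_neg_one_pow_mul_mC (Finset.mem_powerset.1 hJ) hK h0 h0inv)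
  push_cast at h
  rw [← Finset.sum_smul, h, mul_smul_comm, mul_comm]

theorem conjF_subset (h0 : IsLongestIn cs (Simples cs) w0) {J : Finset W}
    (hJ : J ⊆ Simples cs) : conjF w0 J ⊆ Simples cs := by
  intro x hx
  obtain ⟨y, hy, rfl⟩ := Finset.mem_image.1 hx
  exact h0.conj_mem subset_rfl (hJ hy)

omit [Fintype W] in
theorem card_conjF (w : W) (J : Finset W) : #(conjF w J) = #J :=
  Finset.card_image_of_injective J (MulAut.conj w).injective

omit [Fintype W] in
theorem conjF_conjF (w v : W) (J : Finset W) : conjF w (conjF v J) = conjF (w * v) J := by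
  rw [conjF, conjF, conjF, Finset.image_image]
  congr 1
  funext s
  simp [mul_assoc]

omit [Fintype W] in
theorem conjF_one (J : Finset W) : conjF 1 J = J := by
  simp [conjF]

omit [Fintype W] in
theorem conjF_subset_conjF_iff (w : W) {J K : Finset W} : conjF w J ⊆ conjF w K ↔ J ⊆ K :=
  Finset.image_subset_image_iff (MulAut.conj w).injective

omit [DecidableEq W] in
theorem isRightInversion_conj_longest_iff
    (h0inv : ∀ t, cs.IsReflection t → cs.IsRightInversion w0 t)
    (h0 : IsLongestIn cs (Simples cs) w0) {w t : W} (ht : cs.IsReflection t) :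
    cs.IsRightInversion (w0 * w * w0⁻¹) (w0 * t * w0⁻¹) ↔ cs.IsRightInversion w t := by
  have h1 := h0inv _ (ht.conj w0)
  have h2 := h0inv _ (ht.conj w)
  have e1 : w0⁻¹ * (w0 * t * w0⁻¹) * w0⁻¹⁻¹ = t := by group
  rw [isRightInversion_mul_iff, isRightInversion_mul_iff, e1, h0.inv_eq subset_rfl]
  rw [h0.inv_eq subset_rfl] at h1
  tauto

omit [Fintype W] in
theorem forall_mem_conjF {w : W} {J : Finset W} {p : W → Prop} :
    (∀ s ∈ conjF w J, p s) ↔ ∀ s ∈ J, p (w * s * w⁻¹) := by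
  simp [conjF]

omit [DecidableEq W] in
theorem conj_mem_Simples_iff (h0 : IsLongestIn cs (Simples cs) w0) {s : W} :
    w0 * s * w0⁻¹ ∈ Simples cs ↔ s ∈ Simples cs := by
  refine ⟨fun h => ?_, fun h => h0.conj_mem subset_rfl h⟩
  have h' := h0.conj_mem subset_rfl h
  rwa [← mul_assoc, ← mul_assoc, h0.mul_self subset_rfl, one_mul, mul_assoc, ← mul_inv_rev,
    h0.mul_self subset_rfl, inv_one, mul_one] at h'

theorem mem_minCoset_conjF_iff (h0 : IsLongestIn cs (Simples cs) w0)
    (h0inv : ∀ t, cs.IsReflection t → cs.IsRightInversion w0 t)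
    {K : Finset W} (hK : K ⊆ Simples cs) {w : W} :
    w0 * w * w0⁻¹ ∈ minCoset cs Set.univ (conjF w0 K) ↔ w ∈ minCoset cs Set.univ K := by
  rw [mem_minCoset_univ cs (conjF_subset h0 hK), mem_minCoset_univ cs hK, forall_mem_conjF]
  refine forall₂_congr fun s hs => not_congr ?_
  exact isRightInversion_conj_longest_iff h0inv h0 (isReflection_of_mem_Simples cs (hK hs))

theorem takes_conjF_iff (h0 : IsLongestIn cs (Simples cs) w0)
    (h0inv : ∀ t, cs.IsReflection t → cs.IsRightInversion w0 t)
    {J : Finset W} (hJ : J ⊆ Simples cs) {w : W} :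
    Takes cs (Simples cs) (w0 * w * w0⁻¹) (conjF w0 J) ↔ Takes cs (Simples cs) w J := by
  rw [takes_iff cs (conjF_subset h0 hJ), takes_iff cs hJ, forall_mem_conjF]
  refine forall₂_congr fun s hs => and_congr ?_ (not_congr ?_)
  · rw [← conj_mem_Simples_iff h0 (s := w * s * w⁻¹)]
    simp [mul_assoc]
  · exact isRightInversion_conj_longest_iff h0inv h0 (isReflection_of_mem_Simples cs (hJ hs))

theorem mC_conjF (h0 : IsLongestIn cs (Simples cs) w0)
    (h0inv : ∀ t, cs.IsReflection t → cs.IsRightInversion w0 t)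
    {J K : Finset W} (hJK : J ⊆ K) (hK : K ⊆ Simples cs) :
    mC cs Set.univ (Simples cs) (fun _ => 1) (conjF w0 J) (conjF w0 K) =
      mC cs Set.univ (Simples cs) (fun _ => 1) J K := by
  rw [mC, mC, if_pos hJK, if_pos ((conjF_subset_conjF_iff w0).2 hJK)]
  symm
  refine Finset.sum_equiv (MulAut.conj w0).toEquiv (fun w => ?_) fun _ _ => rfl
  simp only [Finset.mem_filter]
  exact and_congr (mem_minCoset_conjF_iff h0 h0inv hK).symm
    (takes_conjF_iff h0 h0inv (hJK.trans hK)).symm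

theorem xRel_conjF (h0 : IsLongestIn cs (Simples cs) w0)
    (h0inv : ∀ t, cs.IsReflection t → cs.IsRightInversion w0 t)
    {K : Finset W} (hK : K ⊆ Simples cs) :
    xRel cs Set.univ (conjF w0 K) = of ℂ W w0 * xRel cs Set.univ K * of ℂ W w0 := by
  rw [xRel, xRel, Finset.mul_sum, Finset.sum_mul]
  symm
  refine Finset.sum_equiv (MulAut.conj w0).toEquiv
    (fun w => (mem_minCoset_conjF_iff h0 h0inv hK).symm) fun w _ => ?_
  rw [← map_mul, ← map_mul]
  congr 1
  change _ = w0 * w * w0⁻¹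
  rw [h0.inv_eq subset_rfl]

omit [DecidableEq W] in
theorem of_mul_of_mul_mul_of (h0 : IsLongestIn cs (Simples cs) w0) (a : MonoidAlgebra ℂ W) :
    of ℂ W w0 * (of ℂ W w0 * a * of ℂ W w0) * of ℂ W w0 = a := by
  rw [mul_assoc, mul_assoc, mul_assoc, ← map_mul, h0.mul_self subset_rfl, map_one, mul_one,
    ← mul_assoc, ← map_mul, h0.mul_self subset_rfl, map_one, one_mul]

theorem IsBBHT.conj {e : Finset W → MonoidAlgebra ℂ W}
    (he : IsBBHT cs Set.univ (Simples cs) (fun _ => 1) e)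
    (h0 : IsLongestIn cs (Simples cs) w0)
    (h0inv : ∀ t, cs.IsReflection t → cs.IsRightInversion w0 t) :
    IsBBHT cs Set.univ (Simples cs) (fun _ => 1)
      (fun J => of ℂ W w0 * e (conjF w0 J) * of ℂ W w0) := by
  intro K hK
  rw [Finset.mem_powerset] at hK
  have hinvol : ∀ J : Finset W, conjF w0 (conjF w0 J) = J := fun J => by
    rw [conjF_conjF, h0.mul_self subset_rfl, conjF_one]
  rw [← of_mul_of_mul_mul_of h0 (xRel cs Set.univ K), ← xRel_conjF h0 h0inv hK,
    he _ (Finset.mem_powerset.2 (conjF_subset h0 hK)), Finset.mul_sum, Finset.sum_mul]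
  symm
  refine Finset.sum_nbij' (conjF w0) (conjF w0) ?_ ?_ (fun J _ => hinvol J)
    (fun J _ => hinvol J) ?_
  · intro J hJ
    rw [Finset.mem_powerset] at hJ ⊢
    exact (conjF_subset_conjF_iff w0).2 hJ
  · intro J hJ
    rw [Finset.mem_powerset] at hJ ⊢
    rw [← hinvol K]
    exact (conjF_subset_conjF_iff w0).2 hJ
  · intro J hJ
    rw [mC_conjF h0 h0inv (Finset.mem_powerset.1 hJ) hK, mul_smul_comm, smul_mul_assoc]

end QuasiIdempotents

/-- Lemma 3.3(b): with `σ ≡ 1`, for every `J ⊆ S` one has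
`w₀ e_J = (−1)^{|J|} e_J`, `w₀ e_J w₀ = e_{J^{w₀}}` and
`e_J w₀ = (−1)^{|J|} e_{J^{w₀}}`, where `J^{w₀} = w₀ J w₀`. -/
theorem stmt3 (cs : CoxeterSystem M W)
    (e : Finset W → MonoidAlgebra ℂ W)
    (he : IsBBHT cs Set.univ (Simples cs) (fun _ => (1 : ℝ)) e)
    (w0 : W) (hw0 : ∀ w : W, w ≠ w0 → cs.length w < cs.length w0)
    (J : Finset W) (hJ : J ⊆ Simples cs) :
    (of ℂ W w0 * e J = ((-1 : ℂ)) ^ J.card • e J) ∧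
    (of ℂ W w0 * e J * of ℂ W w0 = e (conjF w0 J)) ∧
    (e J * of ℂ W w0 = ((-1 : ℂ)) ^ J.card • e (conjF w0 J)) := by
  have h0 := isLongestIn_Simples_of_maximal hw0
  have h0inv := isRightInversion_of_maximal hw0
  have left : ∀ I, I ⊆ Simples cs → of ℂ W w0 * e I = (-1 : ℂ) ^ #I • e I := by
    intro I hI
    nth_rw 2 [he.eq_of_subset (he.smul_of_mul h0 h0inv) hI]
    rw [smul_smul, ← mul_pow, neg_one_mul, neg_neg, one_pow, one_smul]
  have conj : of ℂ W w0 * e J * of ℂ W w0 = e (conjF w0 J) := by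
    rw [he.eq_of_subset (he.conj h0 h0inv) hJ, of_mul_of_mul_mul_of h0]
  refine ⟨left J hJ, conj, ?_⟩
  rw [← card_conjF w0 J, ← left _ (conjF_subset h0 hJ), ← conj, ← mul_assoc, ← mul_assoc,
    ← map_mul, h0.mul_self subset_rfl, map_one, one_mul]

end DPR
end
end

section
/- Suppose S = S₁ ⊔ S₂ is a disjoint union with st = ts for every s ∈ S₁ and t ∈ S₂ (so W ≅ W_{S₁} × W_{S₂}), and suppose σ : 2^S → ℝ_{>0} satisfies σ(J) = σ(J ∩ S₁) · σ(J ∩ S₂) for every J ⊆ S. For i = 1, 2 let σ_i be the restriction of σ to 2^{S_i} and let e^{σ_i}_{J∩S_i} ∈ ℂW_{S_i} ⊆ ℂW be the BBHT quasi-idempotents computed inside the Coxeter system (W_{S_i}, S_i). Then e^σ_J = e^{σ_1}_{J∩S₁} · e^{σ_2}_{J∩S₂} in ℂW for every J ⊆ S; in particular, for σ ≡ 1, e_J = e_{J∩S₁} e_{J∩S₂}. -/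
open scoped Classical
open MonoidAlgebra Finset

noncomputable section

namespace DPR

variable {B : Type} {W : Type} [Group W] [Fintype W] [DecidableEq W]
  {M : CoxeterMatrix B}

theorem mem_simples {cs : CoxeterSystem M W} {w : W} : w ∈ Simples cs ↔ ∃ i, cs.simple i = w := by
  simp [Simples]

theorem mem_minCoset {cs : CoxeterSystem M W} {H : Set W} {I : Finset W} {w : W} :
    w ∈ minCoset cs H I ↔ w ∈ H ∧ ∀ s ∈ I, cs.length w < cs.length (w * s) := by
  simp [minCoset]

/-- If the simple reflections split into two commuting disjoint sets, there is an endomorphism of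
the group fixing the first set pointwise and killing the second. -/
theorem exists_projection (cs : CoxeterSystem M W) {S1 S2 : Finset W} (hdisj : Disjoint S1 S2)
    (hunion : S1 ∪ S2 = Simples cs) (hcomm : ∀ s ∈ S1, ∀ t ∈ S2, s * t = t * s) :
    ∃ p : W →* W, (∀ s ∈ S1, p s = s) ∧ ∀ t ∈ S2, p t = 1 := by
  have hpow : ∀ i j, cs.simple i ∈ S1 → cs.simple j ∉ S1 → cs.simple i ^ M i j = 1 := by
    intro i j hi hj
    have hj2 : cs.simple j ∈ S2 := by
      have h : cs.simple j ∈ S1 ∪ S2 := hunion ▸ mem_simples.2 ⟨j, rfl⟩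
      exact (mem_union.1 h).resolve_left hj
    have hsq : ∀ k, cs.simple k ^ 2 = 1 := fun k => by
      rw [pow_two, cs.simple_mul_simple_self]
    rcases Nat.even_or_odd' (M i j) with ⟨n, hn | hn⟩
    · rw [hn, pow_mul, hsq, one_pow]
    · exfalso
      have h := cs.simple_mul_simple_pow i j
      rw [(show Commute _ _ from hcomm _ hi _ hj2).mul_pow, hn, pow_succ, pow_mul, hsq,
        pow_succ, pow_mul, hsq] at h
      simp only [one_pow, one_mul] at h
      rw [mul_eq_one_iff_eq_inv, cs.inv_simple] at h
      exact hj (h ▸ hi)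
  have hlift : M.IsLiftable fun i => if cs.simple i ∈ S1 then cs.simple i else 1 := by
    intro i j
    by_cases hi : cs.simple i ∈ S1 <;> by_cases hj : cs.simple j ∈ S1
    · simp [hi, hj]
    · simp [hi, hj, hpow i j hi hj]
    · simp [hi, hj, M.symmetric i j ▸ hpow j i hj hi]
    · simp [hi, hj]
  refine ⟨cs.lift ⟨_, hlift⟩, fun s hs => ?_, fun t ht => ?_⟩
  · obtain ⟨i, rfl⟩ := mem_simples.1 (hunion ▸ mem_union_left _ hs : s ∈ Simples cs)
    rw [cs.lift_apply_simple, if_pos hs]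
  · obtain ⟨i, rfl⟩ := mem_simples.1 (hunion ▸ mem_union_right _ ht : t ∈ Simples cs)
    rw [cs.lift_apply_simple, if_neg (disjoint_right.1 hdisj ht)]

/-- The endomorphisms `p1`, `p2` are the projections onto the two factors of a decomposition
`W = W_{S1} × W_{S2}` of a Coxeter system. -/
structure IsSplitting (cs : CoxeterSystem M W) (S1 S2 : Finset W) (p1 p2 : W →* W) : Prop where
  union : S1 ∪ S2 = Simples cs
  comm : ∀ s ∈ S1, ∀ t ∈ S2, s * t = t * s
  fst_left : ∀ s ∈ S1, p1 s = s
  fst_right : ∀ t ∈ S2, p1 t = 1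
  snd_left : ∀ s ∈ S1, p2 s = 1
  snd_right : ∀ t ∈ S2, p2 t = t

namespace IsSplitting

variable {cs : CoxeterSystem M W} {S1 S2 : Finset W} {p1 p2 : W →* W}

theorem symm (h : IsSplitting cs S1 S2 p1 p2) : IsSplitting cs S2 S1 p2 p1 where
  union := by rw [union_comm, h.union]
  comm t ht s hs := (h.comm s hs t ht).symm
  fst_left := h.snd_right
  fst_right := h.snd_left
  snd_left := h.fst_right
  snd_right := h.fst_left

theorem simple_mem (h : IsSplitting cs S1 S2 p1 p2) (i : B) :
    cs.simple i ∈ S1 ∨ cs.simple i ∈ S2 :=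
  mem_union.1 (h.union ▸ mem_simples.2 ⟨i, rfl⟩)

theorem ne_one (h : IsSplitting cs S1 S2 p1 p2) {s : W} (hs : s ∈ S1) : s ≠ 1 := by
  obtain ⟨i, rfl⟩ := mem_simples.1 (h.union ▸ mem_union_left _ hs : s ∈ Simples cs)
  intro h1
  simpa [h1] using cs.length_simple i

theorem fst_mem (h : IsSplitting cs S1 S2 p1 p2) (w : W) :
    p1 w ∈ Subgroup.closure (S1 : Set W) := by
  refine cs.simple_induction (p := fun w => p1 w ∈ Subgroup.closure (S1 : Set W)) w
    (fun i => ?_) (by simp) fun a b ha hb => ?_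
  · rcases h.simple_mem i with hi | hi
    · rw [h.fst_left _ hi]; exact Subgroup.subset_closure hi
    · rw [h.fst_right _ hi]; exact one_mem _
  · rw [map_mul]; exact mul_mem ha hb

theorem fst_of_mem_left (h : IsSplitting cs S1 S2 p1 p2) {a : W}
    (ha : a ∈ Subgroup.closure (S1 : Set W)) : p1 a = a :=
  MonoidHom.eqOn_closure (f := p1) (g := MonoidHom.id W) h.fst_left ha

theorem snd_of_mem_left (h : IsSplitting cs S1 S2 p1 p2) {a : W}
    (ha : a ∈ Subgroup.closure (S1 : Set W)) : p2 a = 1 :=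
  MonoidHom.eqOn_closure (f := p2) (g := 1) h.snd_left ha

theorem commute_of_mem (h : IsSplitting cs S1 S2 p1 p2) {a b : W}
    (ha : a ∈ Subgroup.closure (S1 : Set W)) (hb : b ∈ Subgroup.closure (S2 : Set W)) :
    Commute a b := by
  have h1 : ∀ t ∈ S2, Commute a t := fun t ht =>
    Subgroup.closure_induction (p := fun x _ => Commute x t) (fun s hs => h.comm s hs t ht)
      (Commute.one_left t) (fun _ _ _ _ hx hy => hx.mul_left hy) (fun _ _ hx => hx.inv_left) ha
  exact Subgroup.closure_induction (p := fun x _ => Commute a x) h1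
    (Commute.one_right a) (fun _ _ _ _ hx hy => hx.mul_right hy) (fun _ _ hx => hx.inv_right) hb

theorem commute (h : IsSplitting cs S1 S2 p1 p2) (v w : W) : Commute (p1 v) (p2 w) :=
  h.commute_of_mem (h.fst_mem v) (h.symm.fst_mem w)

theorem fst_mul_snd (h : IsSplitting cs S1 S2 p1 p2) (w : W) : p1 w * p2 w = w := by
  refine cs.simple_induction (p := fun w => p1 w * p2 w = w) w
    (fun i => ?_) (by simp) fun a b ha hb => ?_
  · rcases h.simple_mem i with hi | hi
    · rw [h.fst_left _ hi, h.snd_left _ hi, mul_one]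
    · rw [h.fst_right _ hi, h.snd_right _ hi, one_mul]
  · rw [map_mul, map_mul, (h.commute b a).mul_mul_mul_comm, ha, hb]

theorem length_add_length_le (h : IsSplitting cs S1 S2 p1 p2) (ω : List B) :
    cs.length (p1 (cs.wordProd ω)) + cs.length (p2 (cs.wordProd ω)) ≤ ω.length := by
  induction ω with
  | nil => simp
  | cons i ω ih =>
    rw [cs.wordProd_cons, map_mul, map_mul, List.length_cons]
    rcases h.simple_mem i with hi | hi
    · rw [h.fst_left _ hi, h.snd_left _ hi, one_mul]
      have := cs.length_mul_le (cs.simple i) (p1 (cs.wordProd ω))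
      rw [cs.length_simple] at this
      omega
    · rw [h.fst_right _ hi, h.snd_right _ hi, one_mul]
      have := cs.length_mul_le (cs.simple i) (p2 (cs.wordProd ω))
      rw [cs.length_simple] at this
      omega

theorem length_eq (h : IsSplitting cs S1 S2 p1 p2) (w : W) :
    cs.length w = cs.length (p1 w) + cs.length (p2 w) := by
  apply le_antisymm
  · conv_lhs => rw [← h.fst_mul_snd w]
    exact cs.length_mul_le _ _
  · obtain ⟨ω, hω, rfl⟩ := cs.exists_isReduced w
    rw [hω.eq]
    exact h.length_add_length_le ω

theorem length_mul_left (h : IsSplitting cs S1 S2 p1 p2) (w : W) {s : W} (hs : s ∈ S1) :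
    cs.length (w * s) = cs.length (p1 w * s) + cs.length (p2 w) := by
  rw [h.length_eq, map_mul, map_mul, h.fst_left s hs, h.snd_left s hs, mul_one]

theorem conj_left (h : IsSplitting cs S1 S2 p1 p2) (w : W) {s : W} (hs : s ∈ S1) :
    w * s * w⁻¹ = p1 w * s * (p1 w)⁻¹ := by
  have hc : Commute s (p2 w) :=
    h.commute_of_mem (Subgroup.subset_closure hs) (h.symm.fst_mem w)
  conv_lhs => rw [← h.fst_mul_snd w]
  rw [mul_assoc (p1 w), ← hc.eq]
  group

theorem fst_mul (h : IsSplitting cs S1 S2 p1 p2) {a b : W}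
    (ha : a ∈ Subgroup.closure (S1 : Set W)) (hb : b ∈ Subgroup.closure (S2 : Set W)) :
    p1 (a * b) = a := by
  rw [map_mul, h.fst_of_mem_left ha, h.symm.snd_of_mem_left hb, mul_one]

theorem snd_mul (h : IsSplitting cs S1 S2 p1 p2) {a b : W}
    (ha : a ∈ Subgroup.closure (S1 : Set W)) (hb : b ∈ Subgroup.closure (S2 : Set W)) :
    p2 (a * b) = b := by
  rw [map_mul, h.snd_of_mem_left ha, h.symm.fst_of_mem_left hb, one_mul]

theorem disjoint (h : IsSplitting cs S1 S2 p1 p2) : Disjoint S1 S2 :=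
  disjoint_left.2 fun s hs1 hs2 => h.ne_one hs1 ((h.fst_left s hs1).symm.trans (h.fst_right s hs2))

theorem inter_union_inter (h : IsSplitting cs S1 S2 p1 p2) {J : Finset W} (hJ : J ⊆ Simples cs) :
    J ∩ S1 ∪ J ∩ S2 = J := by
  rw [← inter_union_distrib_left, h.union, inter_eq_left.2 hJ]

theorem union_inter_left (h : IsSplitting cs S1 S2 p1 p2) {J1 J2 : Finset W} (h1 : J1 ⊆ S1)
    (h2 : J2 ⊆ S2) : (J1 ∪ J2) ∩ S1 = J1 := by
  rw [union_inter_distrib_right, inter_eq_left.2 h1,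
    disjoint_iff_inter_eq_empty.1 (h.disjoint.symm.mono_left h2), union_empty]

theorem union_inter_right (h : IsSplitting cs S1 S2 p1 p2) {J1 J2 : Finset W} (h1 : J1 ⊆ S1)
    (h2 : J2 ⊆ S2) : (J1 ∪ J2) ∩ S2 = J2 := by
  rw [union_comm, h.symm.union_inter_left h2 h1]

/-- A property of elements of `J` holds on `J` iff it holds on both of its parts. -/
theorem forall_mem_iff (h : IsSplitting cs S1 S2 p1 p2) {J : Finset W} (hJ : J ⊆ Simples cs)
    (P : W → Prop) : (∀ s ∈ J, P s) ↔ (∀ s ∈ J ∩ S1, P s) ∧ ∀ s ∈ J ∩ S2, P s := by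
  conv_lhs => rw [← h.inter_union_inter hJ]
  simp only [forall_mem_union]

theorem mem_minCoset_iff (h : IsSplitting cs S1 S2 p1 p2) {K : Finset W} (hK : K ⊆ Simples cs)
    (w : W) : w ∈ minCoset cs Set.univ K ↔
      p1 w ∈ minCoset cs (Subgroup.closure (S1 : Set W) : Set W) (K ∩ S1) ∧
      p2 w ∈ minCoset cs (Subgroup.closure (S2 : Set W) : Set W) (K ∩ S2) := by
  simp only [mem_minCoset, Set.mem_univ, true_and, SetLike.mem_coe, h.fst_mem, h.symm.fst_mem]
  rw [h.forall_mem_iff hK]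
  refine and_congr (forall₂_congr fun s hs => ?_) (forall₂_congr fun s hs => ?_)
  · rw [h.length_eq w, h.length_mul_left w (mem_inter.1 hs).2]; omega
  · rw [h.symm.length_eq w, h.symm.length_mul_left w (mem_inter.1 hs).2]; omega

theorem conj_mem_iff (h : IsSplitting cs S1 S2 p1 p2) (w : W) {s : W} (hs : s ∈ S1) :
    w * s * w⁻¹ ∈ Simples cs ↔ p1 w * s * (p1 w)⁻¹ ∈ S1 := by
  rw [h.conj_left w hs, ← h.union, mem_union, or_iff_left]
  intro hmem
  have hcl : p1 w * s * (p1 w)⁻¹ ∈ Subgroup.closure (S1 : Set W) :=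
    mul_mem (mul_mem (h.fst_mem w) (Subgroup.subset_closure hs)) (inv_mem (h.fst_mem w))
  exact h.symm.ne_one hmem ((h.fst_of_mem_left hcl).symm.trans (h.fst_right _ hmem))

theorem takes_iff (h : IsSplitting cs S1 S2 p1 p2) {J : Finset W} (hJ : J ⊆ Simples cs)
    (w : W) : Takes cs (Simples cs) w J ↔
      Takes cs S1 (p1 w) (J ∩ S1) ∧ Takes cs S2 (p2 w) (J ∩ S2) := by
  unfold Takes
  rw [h.forall_mem_iff hJ]
  refine and_congr (forall₂_congr fun s hs => ?_) (forall₂_congr fun s hs => ?_)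
  · rw [h.conj_mem_iff w (mem_inter.1 hs).2, h.length_eq w,
      h.length_mul_left w (mem_inter.1 hs).2]
    refine and_congr_right fun _ => ?_
    omega
  · rw [h.symm.conj_mem_iff w (mem_inter.1 hs).2, h.symm.length_eq w,
      h.symm.length_mul_left w (mem_inter.1 hs).2]
    refine and_congr_right fun _ => ?_
    omega

theorem conjF_inter (h : IsSplitting cs S1 S2 p1 p2) {J : Finset W} (w : W) :
    conjF w (J ∩ S1) = conjF (p1 w) (J ∩ S1) :=
  image_congr fun _ hs => h.conj_left w (mem_inter.1 hs).2

theorem conjF_eq (h : IsSplitting cs S1 S2 p1 p2) {J : Finset W} (hJ : J ⊆ Simples cs) (w : W) :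
    conjF w J = conjF (p1 w) (J ∩ S1) ∪ conjF (p2 w) (J ∩ S2) := by
  rw [← h.conjF_inter, ← h.symm.conjF_inter, conjF, conjF, conjF, ← image_union,
    h.inter_union_inter hJ]

/-- Sums over `W` of functions supported on products of `A1 ⊆ W_{S1}` and `A2 ⊆ W_{S2}`. -/
theorem sum_eq_sum_sum {R : Type*} [AddCommMonoid R] (h : IsSplitting cs S1 S2 p1 p2)
    {A A1 A2 : Finset W} (hA1 : ∀ a ∈ A1, a ∈ Subgroup.closure (S1 : Set W))
    (hA2 : ∀ b ∈ A2, b ∈ Subgroup.closure (S2 : Set W))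
    (hA : ∀ w, w ∈ A ↔ p1 w ∈ A1 ∧ p2 w ∈ A2) (f : W → W → R) :
    ∑ w ∈ A, f (p1 w) (p2 w) = ∑ a ∈ A1, ∑ b ∈ A2, f a b := by
  rw [← sum_product']
  refine sum_nbij' (fun w => (p1 w, p2 w)) (fun x => x.1 * x.2) (fun w hw => ?_) (fun x hx => ?_)
    (fun w _ => h.fst_mul_snd w) (fun x hx => ?_) fun _ _ => rfl
  · exact mem_product.2 ((hA w).1 hw)
  · obtain ⟨h1, h2⟩ := mem_product.1 hx
    rw [hA, h.fst_mul (hA1 _ h1) (hA2 _ h2), h.snd_mul (hA1 _ h1) (hA2 _ h2)]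
    exact ⟨h1, h2⟩
  · obtain ⟨h1, h2⟩ := mem_product.1 hx
    exact Prod.ext (h.fst_mul (hA1 _ h1) (hA2 _ h2)) (h.snd_mul (hA1 _ h1) (hA2 _ h2))

theorem xRel_eq_mul (h : IsSplitting cs S1 S2 p1 p2) {K : Finset W} (hK : K ⊆ Simples cs) :
    xRel cs Set.univ K = xRel cs (Subgroup.closure (S1 : Set W) : Set W) (K ∩ S1) *
      xRel cs (Subgroup.closure (S2 : Set W) : Set W) (K ∩ S2) := by
  unfold xRel
  rw [sum_mul_sum, ← h.sum_eq_sum_sum (fun a ha => (mem_minCoset.1 ha).1)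
    (fun b hb => (mem_minCoset.1 hb).1) (h.mem_minCoset_iff hK)]
  exact sum_congr rfl fun w _ => by rw [← map_mul, h.fst_mul_snd]

theorem mC_eq_mul (h : IsSplitting cs S1 S2 p1 p2) {σ : Finset W → ℝ}
    (hσ : ∀ J ⊆ Simples cs, σ J = σ (J ∩ S1) * σ (J ∩ S2)) {J K : Finset W} (hJK : J ⊆ K)
    (hK : K ⊆ Simples cs) :
    mC cs Set.univ (Simples cs) σ J K =
      mC cs (Subgroup.closure (S1 : Set W) : Set W) S1 σ (J ∩ S1) (K ∩ S1) *
      mC cs (Subgroup.closure (S2 : Set W) : Set W) S2 σ (J ∩ S2) (K ∩ S2) := by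
  have hJ := hJK.trans hK
  unfold mC
  rw [if_pos hJK, if_pos (inter_subset_inter_right hJK), if_pos (inter_subset_inter_right hJK),
    sum_mul_sum, ← h.sum_eq_sum_sum
      (fun a ha => (mem_minCoset.1 (mem_filter.1 ha).1).1)
      (fun b hb => (mem_minCoset.1 (mem_filter.1 hb).1).1)
      (A := (minCoset cs Set.univ K).filter fun w => Takes cs (Simples cs) w J)]
  · refine sum_congr rfl fun w hw => ?_
    obtain ⟨hT1, hT2⟩ := (h.takes_iff hJ w).1 (mem_filter.1 hw).2
    have h1 : conjF (p1 w) (J ∩ S1) ⊆ S1 := image_subset_iff.2 fun s hs => (hT1 s hs).1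
    have h2 : conjF (p2 w) (J ∩ S2) ⊆ S2 := image_subset_iff.2 fun s hs => (hT2 s hs).1
    rw [h.conjF_eq hJ w, hσ _ (h.union ▸ union_subset_union h1 h2), h.union_inter_left h1 h2,
      h.union_inter_right h1 h2]
  · intro w
    rw [mem_filter, mem_filter, mem_filter, h.mem_minCoset_iff hK, h.takes_iff hJ]
    tauto

/-- Products of quasi-idempotents of the two factors are quasi-idempotents of the whole. -/
theorem isBBHT_mul (h : IsSplitting cs S1 S2 p1 p2) {σ : Finset W → ℝ}
    (hσ : ∀ J ⊆ Simples cs, σ J = σ (J ∩ S1) * σ (J ∩ S2))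
    {e1 e2 : Finset W → MonoidAlgebra ℂ W}
    (he1 : IsBBHT cs (Subgroup.closure (S1 : Set W) : Set W) S1 σ e1)
    (he2 : IsBBHT cs (Subgroup.closure (S2 : Set W) : Set W) S2 σ e2) :
    IsBBHT cs Set.univ (Simples cs) σ fun J => e1 (J ∩ S1) * e2 (J ∩ S2) := by
  intro K hK
  rw [mem_powerset] at hK
  rw [h.xRel_eq_mul hK, he1 _ (mem_powerset.2 inter_subset_right),
    he2 _ (mem_powerset.2 inter_subset_right), sum_mul_sum, ← sum_product']
  symm
  refine sum_nbij' (fun J => (J ∩ S1, J ∩ S2)) (fun x => x.1 ∪ x.2) (fun J hJ => ?_)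
    (fun x hx => ?_) (fun J hJ => ?_) (fun x hx => ?_) (fun J hJ => ?_)
  · rw [mem_powerset] at hJ
    exact mem_product.2 ⟨mem_powerset.2 (inter_subset_inter_right hJ),
      mem_powerset.2 (inter_subset_inter_right hJ)⟩
  · simp only [mem_product, mem_powerset] at hx
    exact mem_powerset.2 (union_subset (hx.1.trans inter_subset_left)
      (hx.2.trans inter_subset_left))
  · exact h.inter_union_inter ((mem_powerset.1 hJ).trans hK)
  · simp only [mem_product, mem_powerset] at hx
    have h1 := hx.1.trans inter_subset_right
    have h2 := hx.2.trans inter_subset_right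
    exact Prod.ext (h.union_inter_left h1 h2) (h.union_inter_right h1 h2)
  · rw [h.mC_eq_mul hσ (mem_powerset.1 hJ) hK, smul_mul_smul_comm, Complex.ofReal_mul]

end IsSplitting

theorem mC_self_pos (cs : CoxeterSystem M W) {σ : Finset W → ℝ} (hσ : PosOn (Simples cs) σ)
    {K : Finset W} (hK : K ⊆ Simples cs) : 0 < mC cs Set.univ (Simples cs) σ K K := by
  have hlen : ∀ s ∈ K, cs.length s = 1 := fun s hs => by
    obtain ⟨i, rfl⟩ := mem_simples.1 (hK hs)
    exact cs.length_simple i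
  rw [mC, if_pos Subset.rfl]
  refine sum_pos (fun w hw => hσ _ (mem_powerset.2 ?_)) ⟨1, mem_filter.2 ⟨?_, ?_⟩⟩
  · exact image_subset_iff.2 fun s hs => ((mem_filter.1 hw).2 s hs).1
  · exact mem_minCoset.2 ⟨Set.mem_univ _, fun s hs => by simp [hlen s hs]⟩
  · exact fun s hs => ⟨by simpa using hK hs, by simp [hlen s hs]⟩

/-- The quasi-idempotents are uniquely determined by their defining triangular system. -/
theorem IsBBHT.unique {cs : CoxeterSystem M W} {σ : Finset W → ℝ} (hσ : PosOn (Simples cs) σ)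
    {e f : Finset W → MonoidAlgebra ℂ W} (he : IsBBHT cs Set.univ (Simples cs) σ e)
    (hf : IsBBHT cs Set.univ (Simples cs) σ f) (K : Finset W) (hK : K ⊆ Simples cs) :
    e K = f K := by
  induction K using Finset.strongInduction with
  | H K ih =>
    have hsum := (he K (mem_powerset.2 hK)).symm.trans (hf K (mem_powerset.2 hK))
    rw [← add_sum_erase _ _ (mem_powerset_self K), ← add_sum_erase _ _ (mem_powerset_self K),
      sum_congr rfl fun J hJ => ?_] at hsum
    · refine smul_right_injective _ ?_ (add_right_cancel hsum)
      exact Complex.ofReal_ne_zero.2 (mC_self_pos cs hσ hK).ne'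
    · obtain ⟨hne, hJK⟩ := mem_erase.1 hJ
      rw [mem_powerset] at hJK
      rw [ih J (hJK.ssubset_of_ne hne) (hJK.trans hK)]

/-- Proposition 3.6: if `S = S₁ ⊔ S₂` with `S₁` and `S₂` commuting (so
`W ≅ W_{S₁} × W_{S₂}`) and `σ(J) = σ(J ∩ S₁)σ(J ∩ S₂)` for all `J ⊆ S`, then
`e^σ_J = e^{σ₁}_{J ∩ S₁} · e^{σ₂}_{J ∩ S₂}` for every `J ⊆ S`, where the factors
are the BBHT quasi-idempotents computed inside the parabolic subsystems
`(W_{S₁}, S₁)` and `(W_{S₂}, S₂)` for the restrictions `σ₁`, `σ₂` of `σ`. -/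
theorem stmt5 (cs : CoxeterSystem M W)
    (S1 S2 : Finset W) (hdisj : Disjoint S1 S2) (hunion : S1 ∪ S2 = Simples cs)
    (hcomm : ∀ s ∈ S1, ∀ t ∈ S2, s * t = t * s)
    (σ : Finset W → ℝ) (hσ : PosOn (Simples cs) σ)
    (hσmul : ∀ J ⊆ Simples cs, σ J = σ (J ∩ S1) * σ (J ∩ S2))
    (e : Finset W → MonoidAlgebra ℂ W) (he : IsBBHT cs Set.univ (Simples cs) σ e)
    (e1 : Finset W → MonoidAlgebra ℂ W)
    (he1 : IsBBHT cs ((Subgroup.closure (S1 : Set W) : Subgroup W) : Set W) S1 σ e1)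
    (e2 : Finset W → MonoidAlgebra ℂ W)
    (he2 : IsBBHT cs ((Subgroup.closure (S2 : Set W) : Subgroup W) : Set W) S2 σ e2) :
    ∀ J ⊆ Simples cs, e J = e1 (J ∩ S1) * e2 (J ∩ S2) := by
  obtain ⟨p1, hp11, hp12⟩ := exists_projection cs hdisj hunion hcomm
  obtain ⟨p2, hp22, hp21⟩ := exists_projection cs hdisj.symm (union_comm S2 S1 ▸ hunion)
    fun t ht s hs => (hcomm s hs t ht).symm
  have h : IsSplitting cs S1 S2 p1 p2 := ⟨hunion, hcomm, hp11, hp12, hp21, hp22⟩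
  exact he.unique hσ (h.isBBHT_mul hσmul he1 he2)

end DPR
end
end
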